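/- There is no equivalent 2-NUC norm on X: if |||·||| is any norm on X for which there exist constants c, C > 0 with c‖x‖_X ≤ |||x||| ≤ C‖x‖_X for all x ∈ X, then (X, |||·|||) is not 2-NUC. -/

import Mathlib

open scoped BigOperators

/-- A node of the dyadic tree `T = ⋃ₙ {0,1}ⁿ`, modelled as a finite list of booleans.
The tree order `φ ≤ ψ` is the prefix order `φ <+: ψ`; the length of a node is its
list length. -/
abbrev Node : Type := List Bool

/-- The subtree `T_φ` consisting of all nodes `ψ` with `φ ≤ ψ`. -/
def Tsub (φ : Node) : Set Node := {ψ | φ <+: ψ}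

/-- `S_φ`: the set of nodes extending `φ` by zeroes (`false`s) only. -/
def Sset (φ : Node) : Set Node := {ψ | ∃ k : ℕ, ψ = φ ++ List.replicate k false}

/-- Two nodes are incomparable if neither is a prefix of the other. -/
def Incomparable (φ ψ : Node) : Prop := ¬ φ <+: ψ ∧ ¬ ψ <+: φ

/-- A finite set `A ⊆ T` is admissible if there is `n` such that every element of `A`
lies in some subtree `T_σ` with `|σ| = n`, and each such subtree contains at most one
element of `A`. -/
def Admissible (A : Finset Node) : Prop :=
  ∃ n : ℕ,
    (∀ φ ∈ A, ∃ σ : Node, σ.length = n ∧ σ <+: φ) ∧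
    (∀ σ : Node, σ.length = n → ∀ φ ∈ A, ∀ ψ ∈ A, σ <+: φ → σ <+: ψ → φ = ψ)

/-- A finite set `A ⊆ T` is acceptable if there is `n` such that every element of `A`
lies in some set `S_σ` with `|σ| = n`, and each such set contains at most one
element of `A`. -/
def Acceptable (A : Finset Node) : Prop :=
  ∃ n : ℕ,
    (∀ φ ∈ A, ∃ σ : Node, σ.length = n ∧ φ ∈ Sset σ) ∧
    (∀ σ : Node, σ.length = n → ∀ φ ∈ A, ∀ ψ ∈ A, φ ∈ Sset σ → ψ ∈ Sset σ → φ = ψ)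

/-- `Before A B` is the relation `A ≪ B`: every node of `A` is strictly shorter than
every node of `B`. -/
def Before (A B : Finset Node) : Prop :=
  ∀ φ ∈ A, ∀ ψ ∈ B, φ.length < ψ.length

/-- The norm `‖·‖_X` on `c₀₀(T)` (finitely supported functions on the tree, modelled
as `Node →₀ ℝ`): the supremum of `(∑ᵢ (∑_{φ ∈ Aᵢ} |x φ|)²)^{1/2}` over all finite
chains `A₁ ≪ ⋯ ≪ A_k` of admissible sets. -/
noncomputable def normX (x : Node →₀ ℝ) : ℝ :=
  sSup { r : ℝ | ∃ (k : ℕ) (A : Fin k → Finset Node),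
    (∀ i, Admissible (A i)) ∧ (∀ i j : Fin k, i < j → Before (A i) (A j)) ∧
    r = Real.sqrt (∑ i, (∑ φ ∈ A i, |x φ|) ^ 2) }

/-- The norm `‖·‖_Y` on `c₀₀(T)`: as `normX` but with acceptable sets. -/
noncomputable def normY (x : Node →₀ ℝ) : ℝ :=
  sSup { r : ℝ | ∃ (k : ℕ) (A : Fin k → Finset Node),
    (∀ i, Acceptable (A i)) ∧ (∀ i j : Fin k, i < j → Before (A i) (A j)) ∧
    r = Real.sqrt (∑ i, (∑ φ ∈ A i, |x φ|) ^ 2) }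

/-- The characteristic function `χ_A` of a finite set of nodes, as an element of
`c₀₀(T)`. -/
noncomputable def chi (A : Finset Node) : Node →₀ ℝ :=
  Finsupp.indicator A fun _ _ => (1 : ℝ)

open Classical in
/-- The sup norm `‖y·χ_S‖_∞` of the restriction of `y` to a set `S` of nodes. -/
noncomputable def supOn (y : Node →₀ ℝ) (S : Set Node) : ℝ :=
  sSup (Set.range fun ψ : Node => if ψ ∈ S then |y ψ| else 0)

/-- A branch of the dyadic tree, identified with an infinite 0-1 sequence. -/
abbrev Branch : Type := ℕ → Bool

/-- The node of length `n` on the branch `γ`. -/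
def branchNode (γ : Branch) (n : ℕ) : Node := List.ofFn fun i : Fin n => γ i

/-- A branch `γ` passes through the node `φ` iff `φ ∈ γ`. -/
def PassesThrough (γ : Branch) (φ : Node) : Prop := branchNode γ φ.length = φ

/-- A sequence is `ε`-separated: `inf {‖x_n - x_m‖ : m ≠ n} ≥ ε`. -/
def Separated {Z : Type*} [SeminormedAddGroup Z] (ε : ℝ) (x : ℕ → Z) : Prop :=
  ∀ m n : ℕ, m ≠ n → ε ≤ ‖x m - x n‖

/-- `ε`-separation with respect to a norm function `N`. -/
def SeparatedWith {Z : Type*} [AddGroup Z] (N : Z → ℝ) (ε : ℝ) (x : ℕ → Z) : Prop :=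
  ∀ m n : ℕ, m ≠ n → ε ≤ N (x m - x n)

/-- `N` is a norm on the real vector space `Z`. -/
def IsNormF {Z : Type*} [AddCommGroup Z] [Module ℝ Z] (N : Z → ℝ) : Prop :=
  (∀ x y : Z, N (x + y) ≤ N x + N y) ∧
  (∀ (a : ℝ) (x : Z), N (a • x) = |a| * N x) ∧
  (∀ x : Z, N x = 0 → x = 0)

/-- The `2`-NUC property with respect to a norm function `N`. -/
def TwoNUCWith {Z : Type*} [AddCommGroup Z] (N : Z → ℝ) : Prop :=
  ∀ ε : ℝ, 0 < ε → ∃ δ : ℝ, 0 < δ ∧ δ < 1 ∧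
    ∀ u : ℕ → Z, (∀ n, N (u n) ≤ 1) → SeparatedWith N ε u →
      ∃ n₁ n₂ : ℕ, n₁ < n₂ ∧ N (u n₁ + u n₂) / 2 ≤ 1 - δ

/-- The `1`-β property with respect to a norm function `N`. -/
def OneBetaWith {Z : Type*} [AddCommGroup Z] (N : Z → ℝ) : Prop :=
  ∀ ε : ℝ, 0 < ε → ∃ δ : ℝ, 0 < δ ∧ δ < 1 ∧
    ∀ x : Z, N x ≤ 1 → ∀ u : ℕ → Z, (∀ n, N (u n) ≤ 1) → SeparatedWith N ε u →
      ∃ n : ℕ, N (x + u n) / 2 ≤ 1 - δ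

/-- The property `k`-β of a Banach space. -/
def kBeta (k : ℕ) (Z : Type*) [NormedAddCommGroup Z] : Prop :=
  ∀ ε : ℝ, 0 < ε → ∃ δ : ℝ, 0 < δ ∧ δ < 1 ∧
    ∀ x : Z, ‖x‖ ≤ 1 → ∀ u : ℕ → Z, (∀ n, ‖u n‖ ≤ 1) → Separated ε u →
      ∃ ι : Fin k → ℕ, StrictMono ι ∧ ‖x + ∑ i, u (ι i)‖ / ((k : ℝ) + 1) ≤ 1 - δ

/-- The property `k`-NUC of a Banach space. -/
def kNUC (k : ℕ) (Z : Type*) [NormedAddCommGroup Z] : Prop :=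
  ∀ ε : ℝ, 0 < ε → ∃ δ : ℝ, 0 < δ ∧ δ < 1 ∧
    ∀ u : ℕ → Z, (∀ n, ‖u n‖ ≤ 1) → Separated ε u →
      ∃ ι : Fin k → ℕ, StrictMono ι ∧ ‖∑ i, u (ι i)‖ / (k : ℝ) ≤ 1 - δ

/-- Nearly uniform convexity. -/
def NUC (Z : Type*) [NormedAddCommGroup Z] [NormedSpace ℝ Z] : Prop :=
  ∀ ε : ℝ, 0 < ε → ∃ δ : ℝ, δ < 1 ∧
    ∀ u : ℕ → Z, (∀ n, ‖u n‖ ≤ 1) → Separated ε u →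
      ∃ y ∈ convexHull ℝ (Set.range u), ‖y‖ ≤ δ

/-- The formal sum `∑ i, e_{a i}` of unit vectors of `c₀₀(T)`. -/
noncomputable def unitSum {ι : Type*} [Fintype ι] (a : ι → Node) : Node →₀ ℝ :=
  ∑ i, Finsupp.single (a i) 1

/-- The nodes `a i` extend the restrictions to level `L` of the branches `x i`. -/
def Above {ι : Type*} (x : ι → Branch) (L : ℕ) (a : ι → Node) : Prop :=
  ∀ i, branchNode (x i) L <+: a i

/-- Arbitrarily far along the branches `x i` there are nodes `a i` extending them such that
`∑ i, e_{a i}` has `M`-size at most `R`. -/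
def Reachable {ι : Type*} [Fintype ι] (M : (Node →₀ ℝ) → ℝ) (R : ℝ) (x : ι → Branch) : Prop :=
  ∀ L, ∃ a, Above x L a ∧ M (unitSum a) ≤ R

/-- The reachable tuples of distinct branches indexed by `ι` cannot be blocked by countably many
branches. -/
def Abundant (ι : Type*) [Fintype ι] (M : (Node →₀ ℝ) → ℝ) (R : ℝ) : Prop :=
  ∀ D : Set Branch, D.Countable →
    ∃ x : ι → Branch, Function.Injective x ∧ (∀ i, x i ∉ D) ∧ Reachable M R x

lemma length_branchNode (γ : Branch) (n : ℕ) : (branchNode γ n).length = n := by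
  simp [branchNode]

lemma branchNode_eq_iff {γ η : Branch} {n : ℕ} :
    branchNode γ n = branchNode η n ↔ ∀ i < n, γ i = η i := by
  unfold branchNode
  rw [List.ofFn_inj]
  constructor
  · intro h i hi
    exact congrFun h ⟨i, hi⟩
  · intro h
    funext i
    exact h i i.2

lemma branchNode_prefix_of_le (γ : Branch) {m n : ℕ} (h : m ≤ n) :
    branchNode γ m <+: branchNode γ n := by
  rw [List.prefix_iff_eq_take]
  apply List.ext_getElem
  · simp [branchNode, h]
  · intro i h₁ h₂
    simp [branchNode]

lemma Above.mono {ι : Type*} {x : ι → Branch} {L L' : ℕ} {a : ι → Node} (h : L ≤ L')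
    (ha : Above x L' a) : Above x L a :=
  fun i => (branchNode_prefix_of_le (x i) h).trans (ha i)

/-- Finitely many distinct branches are separated at some level. -/
lemma exists_level_injective {ι : Type*} [Finite ι] {x : ι → Branch}
    (hx : Function.Injective x) :
    ∃ L, ∀ L' ≥ L, Function.Injective fun i => branchNode (x i) L' := by
  have h : ∀ p : ι × ι, ∃ L, ∀ L' ≥ L,
      branchNode (x p.1) L' = branchNode (x p.2) L' → p.1 = p.2 := by
    rintro ⟨i, i'⟩
    by_cases hii : i = i'
    · exact ⟨0, fun _ _ _ => hii⟩
    · obtain ⟨m, hm⟩ := Function.ne_iff.mp (hx.ne hii)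
      exact ⟨m + 1, fun L' hL' he => absurd (branchNode_eq_iff.mp he m (by omega)) hm⟩
  choose f hf using h
  obtain ⟨L, hL⟩ := Finite.exists_le f
  exact ⟨L, fun L' hL' i i' he => hf (i, i') L' ((hL _).trans hL') he⟩

lemma eq_of_prefix_of_length_eq {σ τ φ : Node} (h : σ.length = τ.length) (h₁ : σ <+: φ)
    (h₂ : τ <+: φ) : σ = τ :=
  (List.prefix_of_prefix_length_le h₁ h₂ h.le).eq_of_length h

lemma Above.injective {ι : Type*} {x : ι → Branch} {L : ℕ} {a : ι → Node}
    (hx : Function.Injective fun i => branchNode (x i) L) (ha : Above x L a) :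
    Function.Injective a := by
  intro i i' h
  refine hx (eq_of_prefix_of_length_eq (φ := a i) (by simp [length_branchNode]) (ha i) ?_)
  rw [h]
  exact ha i'

lemma Above.admissible {ι : Type*} [Fintype ι] [DecidableEq Node] {x : ι → Branch} {L : ℕ}
    {a : ι → Node} (hx : Function.Injective fun i => branchNode (x i) L) (ha : Above x L a) :
    Admissible (Finset.univ.image a) := by
  refine ⟨L, ?_, ?_⟩
  · intro φ hφ
    obtain ⟨i, -, rfl⟩ := Finset.mem_image.mp hφ
    exact ⟨_, length_branchNode _ _, ha i⟩
  · intro σ hσ φ hφ ψ hψ h₁ h₂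
    obtain ⟨i, -, rfl⟩ := Finset.mem_image.mp hφ
    obtain ⟨i', -, rfl⟩ := Finset.mem_image.mp hψ
    have e₁ := eq_of_prefix_of_length_eq (by rw [hσ, length_branchNode]) h₁ (ha i)
    have e₂ := eq_of_prefix_of_length_eq (by rw [hσ, length_branchNode]) h₂ (ha i')
    rw [hx (e₁.symm.trans e₂ : branchNode (x i) L = branchNode (x i') L)]

lemma sqrt_sum_sq_le_sum_abs (y : Node →₀ ℝ) {k : ℕ} (A : Fin k → Finset Node)
    (hA : ∀ i j : Fin k, i < j → Before (A i) (A j)) :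
    Real.sqrt (∑ i, (∑ φ ∈ A i, |y φ|) ^ 2) ≤ ∑ φ ∈ y.support, |y φ| := by
  classical
  have hdisj : Set.PairwiseDisjoint (↑(Finset.univ : Finset (Fin k))) A := by
    intro i _ j _ hij
    rw [Function.onFun, Finset.disjoint_left]
    intro φ h₁ h₂
    rcases lt_or_gt_of_ne hij with h | h
    · exact lt_irrefl _ (hA i j h φ h₁ φ h₂)
    · exact lt_irrefl _ (hA j i h φ h₂ φ h₁)
  calc Real.sqrt (∑ i, (∑ φ ∈ A i, |y φ|) ^ 2)
      ≤ Real.sqrt ((∑ i, ∑ φ ∈ A i, |y φ|) ^ 2) :=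
        Real.sqrt_le_sqrt (Finset.sum_sq_le_sq_sum_of_nonneg fun i _ =>
          Finset.sum_nonneg fun _ _ => abs_nonneg _)
    _ = ∑ i, ∑ φ ∈ A i, |y φ| :=
        Real.sqrt_sq (Finset.sum_nonneg fun i _ => Finset.sum_nonneg fun _ _ => abs_nonneg _)
    _ = ∑ φ ∈ Finset.univ.biUnion A, |y φ| := (Finset.sum_biUnion hdisj).symm
    _ ≤ ∑ φ ∈ y.support, |y φ| := by
        rw [← Finset.sum_filter_ne_zero]
        refine Finset.sum_le_sum_of_subset_of_nonneg ?_ fun _ _ _ => abs_nonneg _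
        intro φ hφ
        simpa using (Finset.mem_filter.mp hφ).2

lemma normX_le_sum_abs (y : Node →₀ ℝ) : normX y ≤ ∑ φ ∈ y.support, |y φ| := by
  apply Real.sSup_le
  · rintro r ⟨k, A, -, hA, rfl⟩
    exact sqrt_sum_sq_le_sum_abs y A hA
  · exact Finset.sum_nonneg fun _ _ => abs_nonneg _

lemma Admissible.sum_abs_le_normX {A : Finset Node} (hA : Admissible A) (y : Node →₀ ℝ) :
    ∑ φ ∈ A, |y φ| ≤ normX y := by
  apply le_csSup
  · refine ⟨∑ φ ∈ y.support, |y φ|, ?_⟩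
    rintro r ⟨k, B, -, hB, rfl⟩
    exact sqrt_sum_sq_le_sum_abs y B hB
  · refine ⟨1, fun _ => A, fun _ => hA, fun i j hij => ?_, ?_⟩
    · exact absurd hij (by simp [Subsingleton.elim i j])
    · simp [Real.sqrt_sq (Finset.sum_nonneg fun φ (_ : φ ∈ A) => abs_nonneg (y φ))]

lemma card_le_normX {ι : Type*} [Fintype ι] {x : ι → Branch} {L : ℕ} {a : ι → Node}
    (hx : Function.Injective fun i => branchNode (x i) L) (ha : Above x L a)
    {y : Node →₀ ℝ} (hy : ∀ i, y (a i) = 1) : (Fintype.card ι : ℝ) ≤ normX y := by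
  classical
  refine le_trans (le_of_eq ?_) ((ha.admissible hx).sum_abs_le_normX y)
  rw [Finset.sum_image fun i _ i' _ h => ha.injective hx h]
  simp [hy]

lemma unitSum_apply_of_injective {ι : Type*} [Fintype ι] {a : ι → Node}
    (ha : Function.Injective a) (i : ι) : unitSum a (a i) = 1 := by
  classical
  rw [unitSum, Finsupp.finsetSum_apply, Finset.sum_eq_single i]
  · simp
  · intro i' _ h
    exact Finsupp.single_eq_of_ne' (ha.ne h)
  · simp

lemma unitSum_apply_of_forall_ne {ι : Type*} [Fintype ι] {a : ι → Node} {φ : Node}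
    (h : ∀ i, a i ≠ φ) : unitSum a φ = 0 := by
  classical
  rw [unitSum, Finsupp.finsetSum_apply]
  exact Finset.sum_eq_zero fun i _ => Finsupp.single_eq_of_ne' (h i)

lemma unitSum_sumElim {ι κ : Type*} [Fintype ι] [Fintype κ] (a : ι → Node) (b : κ → Node) :
    unitSum (Sum.elim a b) = unitSum a + unitSum b := by
  simp [unitSum, Fintype.sum_sum_type]

lemma Above.sumElim {ι κ : Type*} {x : ι → Branch} {y : κ → Branch} {L : ℕ} {a : ι → Node}
    {b : κ → Node} (ha : Above x L a) (hb : Above y L b) :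
    Above (Sum.elim x y) L (Sum.elim a b) := by
  rintro (i | i)
  exacts [ha i, hb i]

lemma card_le_normX_sub {ι : Type*} [Fintype ι] {x y : ι → Branch} {L : ℕ} {a b : ι → Node}
    (hxy : Function.Injective fun i => branchNode (Sum.elim x y i) L)
    (ha : Above x L a) (hb : Above y L b) :
    (Fintype.card ι : ℝ) ≤ normX (unitSum a - unitSum b) := by
  have hab := (ha.sumElim hb).injective hxy
  have hx : Function.Injective fun i => branchNode (x i) L := fun i i' h =>
    Sum.inl_injective (hxy (a₁ := Sum.inl i) (a₂ := Sum.inl i') h)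
  refine card_le_normX hx ha fun i => ?_
  rw [Finsupp.sub_apply, unitSum_apply_of_injective (ha.injective hx),
    unitSum_apply_of_forall_ne, sub_zero]
  intro i' h
  exact absurd (hab (a₁ := Sum.inr i') (a₂ := Sum.inl i) h) (by simp)

lemma not_countable_branch : ¬ (Set.univ : Set Branch).Countable := by
  rw [Set.countable_univ_iff]
  intro h
  obtain ⟨f, hf⟩ := exists_surjective_nat Branch
  obtain ⟨n, hn⟩ := hf fun i => !f i i
  simpa using congrFun hn n

/-- An uncountable set of tuples of branches has a point which is a limit of other points of
the set. -/
lemma exists_nonisolated {ι : Type*} [Finite ι] {S : Set (ι → Branch)} (hS : ¬ S.Countable) :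
    ∃ z ∈ S, ∀ L, ∃ x ∈ S, x ≠ z ∧ ∀ i, branchNode (x i) L = branchNode (z i) L := by
  by_contra! hcon
  choose! lev hlev using hcon
  refine hS (Set.MapsTo.countable_of_injOn (t := Set.univ)
    (f := fun z => ((lev z, fun i => branchNode (z i) (lev z)) : ℕ × (ι → Node)))
    (Set.mapsTo_univ _ _) ?_ (Set.to_countable _))
  intro z hz w hw h
  by_contra hne
  obtain ⟨i, hi⟩ := hlev w hw z hz hne
  simp only [Prod.mk.injEq] at h
  have := congrFun h.2 i
  rw [h.1] at this
  exact hi this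

/-- An abundant family contains uncountably many tuples with pairwise disjoint ranges. -/
lemma Abundant.exists_uncountable {ι : Type*} [Fintype ι] [Nonempty ι] {M : (Node →₀ ℝ) → ℝ}
    {R : ℝ} (h : Abundant ι M R) {D : Set Branch} (hD : D.Countable) :
    ∃ S : Set (ι → Branch), ¬ S.Countable ∧
      (∀ x ∈ S, Function.Injective x ∧ (∀ i, x i ∉ D) ∧ Reachable M R x) ∧
      S.Pairwise fun x y => Disjoint (Set.range x) (Set.range y) := by
  obtain ⟨S, hS⟩ := zorn_subset
    {S : Set (ι → Branch) |
      (∀ x ∈ S, Function.Injective x ∧ (∀ i, x i ∉ D) ∧ Reachable M R x) ∧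
      S.Pairwise fun x y => Disjoint (Set.range x) (Set.range y)} (by
    intro c hc hchain
    refine ⟨⋃₀ c, ⟨?_, ?_⟩, fun s hs => Set.subset_sUnion_of_mem hs⟩
    · rintro x ⟨s, hs, hx⟩
      exact (hc hs).1 x hx
    · exact (Set.pairwise_sUnion hchain.directedOn).mpr fun s hs => (hc hs).2)
  refine ⟨S, fun hcount => ?_, hS.prop.1, hS.prop.2⟩
  obtain ⟨x, hinj, hxD, hx⟩ := h (D ∪ ⋃ y ∈ S, Set.range y)
    (hD.union (hcount.biUnion fun y _ => Set.countable_range y))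
  have hdisj : ∀ y ∈ S, Disjoint (Set.range x) (Set.range y) := by
    intro y hy
    rw [Set.disjoint_left]
    rintro _ ⟨i, rfl⟩ hi
    exact hxD i (Or.inr (Set.mem_biUnion hy hi))
  have hmem : x ∈ S := by
    refine hS.le_of_ge (y := insert x S) ⟨?_, ?_⟩ (Set.subset_insert x S) (Set.mem_insert x S)
    · rintro y (rfl | hy)
      · exact ⟨hinj, fun i hi => hxD i (Or.inl hi), hx⟩
      · exact hS.prop.1 y hy
    · exact hS.prop.2.insert fun y hy _ => ⟨hdisj y hy, (hdisj y hy).symm⟩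
  obtain ⟨i⟩ := ‹Nonempty ι›
  exact Set.disjoint_left.mp (hdisj x hmem) ⟨i, rfl⟩ ⟨i, rfl⟩

/-- Suppose every `s`-separated sequence of sums `∑ i, e_{a i}` of `M`-size at most `R` has two
members whose sum has `M`-size at most `R'`. If reachable tuples `x m` with bound `R` converge to
a tuple `z` with all the branches in `x m` and `z` distinct, then some pair `(x m, z)` is
reachable with bound `R'`. -/
lemma exists_reachable_sumElim {ι : Type*} [Fintype ι] {M : (Node →₀ ℝ) → ℝ} {R R' s : ℝ}
    (hM : ∀ a b : ι → Node, M (unitSum a - unitSum b) = M (unitSum b - unitSum a))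
    (hlow : ∀ a b : ι → Node, (Fintype.card ι : ℝ) ≤ normX (unitSum a - unitSum b) →
      s ≤ M (unitSum a - unitSum b))
    (hpair : ∀ a : ℕ → ι → Node, (∀ n, M (unitSum (a n)) ≤ R) →
      SeparatedWith M s (fun n => unitSum (a n)) →
      ∃ n₁ n₂, n₁ < n₂ ∧ M (unitSum (a n₁) + unitSum (a n₂)) ≤ R')
    {z : ι → Branch} {x : ℕ → ι → Branch}
    (hinj : ∀ m, Function.Injective (Sum.elim (x m) z))
    (hreach : ∀ m, Reachable M R (x m))
    (hlim : ∀ m i, branchNode (x m i) m = branchNode (z i) m) :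
    ∃ m, Reachable M R' (Sum.elim (x m) z) := by
  by_contra! hcon
  have hlev : ∀ m, ∃ L, ∀ a b, Above (x m) L a → Above z L b →
      s ≤ M (unitSum a - unitSum b) ∧ R' < M (unitSum a + unitSum b) := by
    intro m
    obtain ⟨L₁, hL₁⟩ := exists_level_injective (hinj m)
    have hm := hcon m
    unfold Reachable at hm
    push Not at hm
    obtain ⟨L₂, hL₂⟩ := hm
    refine ⟨max L₁ L₂, fun a b ha hb => ⟨?_, ?_⟩⟩
    · exact hlow a b (card_le_normX_sub (hL₁ _ (le_max_left _ _)) ha hb)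
    · rw [← unitSum_sumElim]
      exact hL₂ _ ((ha.sumElim hb).mono (le_max_right _ _))
  choose lev hlev using hlev
  let idx : ℕ → ℕ := fun n => Nat.rec 0 (fun _ p => max p (lev p)) n
  have hidx_succ : ∀ n, idx (n + 1) = max (idx n) (lev (idx n)) := fun _ => rfl
  have hmono : Monotone idx := monotone_nat_of_le_succ fun n => by
    rw [hidx_succ]
    exact le_max_left _ _
  have hidx : ∀ {n₁ n₂}, n₁ < n₂ → lev (idx n₁) ≤ idx n₂ := fun {n₁ n₂} h =>
    ((le_max_right _ _).trans (hidx_succ n₁).ge).trans (hmono h)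
  choose a ha haR using fun n => hreach (idx n) (max (lev (idx n)) (idx n))
  have key : ∀ {n₁ n₂}, n₁ < n₂ → s ≤ M (unitSum (a n₁) - unitSum (a n₂)) ∧
      R' < M (unitSum (a n₁) + unitSum (a n₂)) := by
    intro n₁ n₂ h
    refine hlev (idx n₁) _ _ ((ha n₁).mono (le_max_left _ _)) ?_
    refine Above.mono (hidx h) fun i => ?_
    rw [← hlim (idx n₂) i]
    exact (ha n₂).mono (le_max_right _ _) i
  obtain ⟨n₁, n₂, h, hle⟩ := hpair a haR (by
    intro m n hmn
    rcases lt_or_gt_of_ne hmn with h | h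
    · exact (key h).1
    · rw [hM]
      exact (key h).1)
  exact absurd hle (not_le.mpr (key h).2)

lemma Abundant.sum {ι : Type*} [Fintype ι] [Nonempty ι] {M : (Node →₀ ℝ) → ℝ} {R R' s : ℝ}
    (hM : ∀ a b : ι → Node, M (unitSum a - unitSum b) = M (unitSum b - unitSum a))
    (hlow : ∀ a b : ι → Node, (Fintype.card ι : ℝ) ≤ normX (unitSum a - unitSum b) →
      s ≤ M (unitSum a - unitSum b))
    (hpair : ∀ a : ℕ → ι → Node, (∀ n, M (unitSum (a n)) ≤ R) →
      SeparatedWith M s (fun n => unitSum (a n)) →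
      ∃ n₁ n₂, n₁ < n₂ ∧ M (unitSum (a n₁) + unitSum (a n₂)) ≤ R')
    (h : Abundant ι M R) : Abundant (ι ⊕ ι) M R' := by
  intro D hD
  obtain ⟨S, hS, hprop, hdisj⟩ := h.exists_uncountable hD
  obtain ⟨z, hz, hlim⟩ := exists_nonisolated hS
  choose x hxS hxz hxlim using hlim
  have hinj : ∀ m, Function.Injective (Sum.elim (x m) z) := fun m =>
    (hprop _ (hxS m)).1.sumElim (hprop z hz).1 fun i i' he =>
      Set.disjoint_left.mp (hdisj (hxS m) hz (hxz m)) ⟨i, rfl⟩ ⟨i', he.symm⟩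
  obtain ⟨m, hm⟩ := exists_reachable_sumElim hM hlow hpair hinj
    (fun m => (hprop _ (hxS m)).2.2) hxlim
  refine ⟨_, hinj m, ?_, hm⟩
  rintro (i | i)
  exacts [(hprop _ (hxS m)).2.1 i, (hprop z hz).2.1 i]

/-- No positively homogeneous function equivalent to `normX` on `c₀₀(T)` is `2`-NUC. -/
lemma not_twoNUCWith_of_equivalent_normX {M : (Node →₀ ℝ) → ℝ}
    (hhom : ∀ (t : ℝ) (y : Node →₀ ℝ), M (t • y) = |t| * M y)
    {c C : ℝ} (hc : 0 < c) (hC : 0 < C)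
    (hlow : ∀ y, c * normX y ≤ M y) (hup : ∀ y, M y ≤ C * normX y) :
    ¬ TwoNUCWith M := by
  intro hNUC
  obtain ⟨δ, hδ, hδ1, hδM⟩ := hNUC (c / C) (div_pos hc hC)
  have hδ' : 0 < 1 - δ := by linarith
  have habundant : ∀ k : ℕ, ∃ (ι : Type) (_ : Fintype ι), Fintype.card ι = 2 ^ k ∧
      Abundant ι M (C * (2 * (1 - δ)) ^ k) := by
    intro k
    induction k with
    | zero =>
      refine ⟨Unit, inferInstance, by simp, fun D hD => ?_⟩
      obtain ⟨γ, hγ⟩ : ∃ γ, γ ∉ D := by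
        by_contra! h
        exact not_countable_branch (hD.mono fun γ _ => h γ)
      refine ⟨fun _ => γ, Function.injective_of_subsingleton _, fun _ => hγ, fun L =>
        ⟨fun _ => branchNode γ L, fun _ => List.prefix_refl _, ?_⟩⟩
      refine (hup _).trans ?_
      rw [pow_zero]
      gcongr
      refine (normX_le_sum_abs _).trans ?_
      simp [unitSum]
    | succ k ih =>
      obtain ⟨ι, _, hcard, hab⟩ := ih
      have : Nonempty ι := Fintype.card_pos_iff.mp (by rw [hcard]; positivity)
      refine ⟨ι ⊕ ι, inferInstance, by rw [Fintype.card_sum, hcard]; ring, ?_⟩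
      set R := C * (2 * (1 - δ)) ^ k with hR
      have hRpos : 0 < R := by positivity
      have hRle : R ≤ C * 2 ^ k := by
        rw [hR]
        gcongr
        linarith
      refine hab.sum (s := c * 2 ^ k) ?_ ?_ ?_
      · intro a b
        rw [← neg_sub, ← neg_one_smul ℝ, hhom]
        simp
      · intro a b h
        refine le_trans ?_ (hlow _)
        gcongr
        rw [hcard] at h
        exact_mod_cast h
      · intro a haR hsep
        have habs : |R⁻¹| = R⁻¹ := abs_of_pos (inv_pos.mpr hRpos)
        obtain ⟨n₁, n₂, hlt, hle⟩ := hδM (fun n => R⁻¹ • unitSum (a n)) (by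
            intro n
            rw [hhom, habs, inv_mul_le_iff₀ hRpos, mul_one]
            exact haR n) (by
            intro m n hmn
            rw [← smul_sub, hhom, habs, inv_mul_eq_div, div_le_div_iff₀ hC hRpos]
            calc c * R ≤ c * (C * 2 ^ k) := by gcongr
              _ = (c * 2 ^ k) * C := by ring
              _ ≤ _ := by
                gcongr
                exact hsep m n hmn)
        refine ⟨n₁, n₂, hlt, ?_⟩
        rw [← smul_add, hhom, habs, div_le_iff₀ two_pos, inv_mul_le_iff₀ hRpos] at hle
        refine hle.trans (le_of_eq ?_)
        rw [hR]
        ring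
  obtain ⟨k, hk⟩ := exists_pow_lt_of_lt_one (div_pos hc hC) (by linarith : 1 - δ < 1)
  obtain ⟨ι, _, hcard, hab⟩ := habundant k
  obtain ⟨x, hinj, -, hx⟩ := hab ∅ Set.countable_empty
  obtain ⟨L, hL⟩ := exists_level_injective hinj
  obtain ⟨a, ha, haR⟩ := hx L
  have hcard_le := card_le_normX (hL L le_rfl) ha
    (unitSum_apply_of_injective (ha.injective (hL L le_rfl)))
  rw [hcard] at hcard_le
  push_cast at hcard_le
  rw [lt_div_iff₀ hC] at hk
  have : c * 2 ^ k ≤ C * (2 * (1 - δ)) ^ k :=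
    ((mul_le_mul_of_nonneg_left hcard_le hc.le).trans (hlow _)).trans haR
  rw [mul_pow] at this
  have h2 : (0 : ℝ) < 2 ^ k := by positivity
  nlinarith

/-- **Theorem 5.** There is no equivalent `2`-NUC norm on Schachermayer's space `X`
(the completion of `(c₀₀(T), ‖·‖_X)`, represented by a Banach space `X` with a dense
linear isometry `j`): if `N` is a norm on `X` with `c‖x‖ ≤ N x ≤ C‖x‖` for some
`c, C > 0`, then `(X, N)` is not `2`-NUC. -/
theorem no_equivalent_two_NUC_norm_on_X
    (X : Type*) [NormedAddCommGroup X] [NormedSpace ℝ X] [CompleteSpace X]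
    (j : (Node →₀ ℝ) →ₗ[ℝ] X) (hdense : DenseRange j)
    (hiso : ∀ y : Node →₀ ℝ, ‖j y‖ = normX y)
    (N : X → ℝ) (hN : IsNormF N)
    (c C : ℝ) (hc : 0 < c) (hC : 0 < C)
    (hlow : ∀ x : X, c * ‖x‖ ≤ N x) (hup : ∀ x : X, N x ≤ C * ‖x‖) :
    ¬ TwoNUCWith N := by
  intro hNUC
  refine not_twoNUCWith_of_equivalent_normX (M := fun y => N (j y)) ?_ hc hC ?_ ?_ ?_
  · intro t y
    rw [map_smul, hN.2.1]
  · intro y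
    rw [← hiso]
    exact hlow _
  · intro y
    rw [← hiso]
    exact hup _
  · intro ε hε
    obtain ⟨δ, hδ, hδ1, h⟩ := hNUC ε hε
    refine ⟨δ, hδ, hδ1, fun u hu hsep => ?_⟩
    obtain ⟨n₁, n₂, hlt, hle⟩ := h (fun n => j (u n)) hu fun m n hmn => by
      rw [← map_sub]
      exact hsep m n hmn
    refine ⟨n₁, n₂, hlt, ?_⟩
    simpa only [map_add] using hle
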